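/- Let r > 0 and n ≥ 1, and let C := C([-r,0],ℝⁿ) be the space of continuous functions from [-r,0] to ℝⁿ equipped with the sup norm ‖φ‖ = sup{|φ(t)| : t ∈ [-r,0]}. For subsets A, B ⊆ C define the merge set A ⊎ B := A ∪ B ∪ {ψ ∈ C : there exist ψ₁ ∈ A, ψ₂ ∈ B and s ∈ [0,r] such that ψ(t) = ψ₁(s+t) for all t ∈ [-r,-s] and ψ(t) = ψ₂(t+s-r) for all t ∈ [-s,0]}. If A and B are compact subsets of C, then A ⊎ B is compact. -/

import Mathlib

open Set

/-- The merge set `A ⊎ B` of two compact sets of continuous functions on `[-r,0]`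
is compact. -/
theorem merge_set_isCompact (r : ℝ) (hr : 0 < r) (n : ℕ) (hn : 1 ≤ n)
    (A B : Set C(Set.Icc (-r) (0:ℝ), EuclideanSpace ℝ (Fin n)))
    (hA : IsCompact A) (hB : IsCompact B) :
    IsCompact (A ∪ B ∪
      {ψ : C(Set.Icc (-r) (0:ℝ), EuclideanSpace ℝ (Fin n)) |
        ∃ ψ₁ ∈ A, ∃ ψ₂ ∈ B, ∃ s ∈ Set.Icc (0:ℝ) r,
          (∀ (t : ℝ) (ht : t ∈ Set.Icc (-r) (0:ℝ)), t ∈ Set.Icc (-r) (-s) →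
            ∀ (ht' : s + t ∈ Set.Icc (-r) (0:ℝ)), ψ ⟨t, ht⟩ = ψ₁ ⟨s + t, ht'⟩) ∧
          (∀ (t : ℝ) (ht : t ∈ Set.Icc (-r) (0:ℝ)), t ∈ Set.Icc (-s) (0:ℝ) →
            ∀ (ht' : t + s - r ∈ Set.Icc (-r) (0:ℝ)), ψ ⟨t, ht⟩ = ψ₂ ⟨t + s - r, ht'⟩)}) := by
  have hle : -r ≤ (0:ℝ) := by linarith
  refine (hA.union hB).union ?_
  let E := EuclideanSpace ℝ (Fin n)
  let I := Set.Icc (-r) (0:ℝ)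
  let z : I := ⟨0, hle, le_rfl⟩
  let m : I := ⟨-r, le_rfl, hle⟩
  let p : ℝ → I := Set.projIcc (-r) 0 hle
  have hp : Continuous p := continuous_projIcc
  let G : C((C(I, E) × C(I, E) × ℝ) × I, E) :=
    ⟨fun q => q.1.1 (p (q.1.2.2 + q.2)) + q.1.2.1 (p (q.2 + q.1.2.2 - r)) - q.1.2.1 m, by
      fun_prop⟩
  let F : C(C(I, E) × C(I, E) × ℝ, C(I, E)) := G.curry
  have hF : ∀ a b s t, F (a, b, s) t = a (p (s + t)) + b (p (t + s - r)) - b m :=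
    fun a b s t => rfl
  have hK : IsCompact ((A ×ˢ (B ×ˢ Set.Icc (0:ℝ) r)) ∩
      {q : C(I, E) × C(I, E) × ℝ | q.1 z = q.2.1 m}) := by
    refine (hA.prod (hB.prod isCompact_Icc)).inter_right ?_
    exact isClosed_eq (by fun_prop) (by fun_prop)
  have key := hK.image F.continuous
  have hpI : ∀ (x : ℝ) (hx : x ∈ Set.Icc (-r) (0:ℝ)), p x = ⟨x, hx⟩ :=
    fun x hx => Set.projIcc_of_mem hle hx
  have hpz : ∀ x : ℝ, 0 ≤ x → p x = z := fun x hx => Set.projIcc_of_right_le hle hx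
  have hpm : ∀ x : ℝ, x ≤ -r → p x = m := fun x hx => Set.projIcc_of_le_left hle hx
  convert key using 1
  ext ψ
  constructor
  · rintro ⟨a, ha, b, hb, s, hs, h1, h2⟩
    have hs1 := hs.1
    have hs2 := hs.2
    have hm : a z = b m := by
      have e1 := h1 (-s) ⟨by linarith, by linarith⟩ ⟨by linarith, le_rfl⟩
        ⟨by linarith, by linarith⟩
      have e2 := h2 (-s) ⟨by linarith, by linarith⟩ ⟨le_rfl, by linarith⟩
        ⟨by linarith, by linarith⟩
      have e3 := e1.symm.trans e2
      convert e3 using 2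
      · exact Subtype.ext (by simp [z])
      · exact Subtype.ext (by simp [m])
    refine ⟨(a, b, s), ⟨⟨ha, hb, hs⟩, hm⟩, ?_⟩
    ext1 t
    obtain ⟨t, ht⟩ := t
    have ht1 := ht.1
    have ht2 := ht.2
    rw [hF]
    rcases le_total t (-s) with h | h
    · rw [hpm (t + s - r) (by linarith), hpI (s + t) ⟨by linarith, by linarith⟩,
        h1 t ht ⟨ht1, h⟩ ⟨by linarith, by linarith⟩]
      abel
    · rw [hpz _ (by simp only; linarith), hpI (t + s - r) ⟨by linarith, by linarith⟩,
        h2 t ht ⟨h, ht2⟩ ⟨by linarith, by linarith⟩, hm]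
      abel
  · rintro ⟨⟨a, b, s⟩, ⟨⟨ha, hb, hs⟩, hm⟩, rfl⟩
    have hm' : a z = b m := hm
    refine ⟨a, ha, b, hb, s, hs, ?_, ?_⟩
    · intro t ht h ht'
      have h2 := h.2
      rw [hF, hpm (t + s - r) (by linarith), hpI (s + t) ht']
      abel
    · intro t ht h ht'
      have h2 := h.1
      rw [hF, hpz _ (by simp only; linarith), hpI (t + s - r) ht', hm']
      abel
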